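/- For every nonempty proper subset S₁ of {1,...,s+1}, the function ∑_{i∈S₁} g_i is not Lebesgue-integrable on (−π,π]. In particular, the index set {1,...,s+1} cannot be divided into two disjoint nonempty subsets S₁ and S₂ = {1,...,s+1}∖S₁ such that both ∑_{i∈S₁} g_i and ∑_{i∈S₂} g_i are integrable on (−π,π], although the full sum ∑_{i=1}^{s+1} g_i is integrable near each t_j whenever both members of each pair {j, j+1} are included. (The claim of Example 1 and Remark 2, for arbitrary s, that the huddling over the whole set 𝕊 in the spectral expansion is necessary.) -/

import Mathlib

/-- A subset of `Fin (n + 1)` containing, with each index, its neighbours is empty or full. -/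
theorem Finset.exists_not_castSucc_mem_iff_succ_mem {n : ℕ} {S : Finset (Fin (n + 1))}
    (hne : S.Nonempty) (huniv : S ≠ Finset.univ) :
    ∃ j : Fin n, ¬ (j.castSucc ∈ S ↔ j.succ ∈ S) := by
  by_contra! h
  have key : ∀ i, i ∈ S ↔ 0 ∈ S := fun i => by
    induction i using Fin.induction with
    | zero => rfl
    | succ j ih => exact (h j).symm.trans ih
  obtain ⟨i, hi⟩ := hne
  exact huniv (Finset.eq_univ_iff_forall.2 fun k => (key k).2 ((key i).1 hi))

theorem MeasureTheory.IntegrableAtFilter.finset_sum {α ι E : Type*} [MeasurableSpace α]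
    [NormedAddCommGroup E] {μ : Measure α} {l : Filter α} {f : ι → α → E} {S : Finset ι}
    (hf : ∀ i ∈ S, IntegrableAtFilter (f i) l μ) :
    IntegrableAtFilter (fun x => ∑ i ∈ S, f i x) l μ := by
  classical
  induction S using Finset.induction_on with
  | empty => exact ⟨Set.univ, Filter.univ_mem, by simp⟩
  | insert a S ha ih =>
    simp only [Finset.sum_insert ha]
    exact (hf a (Finset.mem_insert_self a S)).add
      (ih fun i hi => hf i (Finset.mem_insert_of_mem hi))

/-- If a finite sum and all summands but one are integrable along a filter, so is the last. -/
theorem MeasureTheory.IntegrableAtFilter.of_finset_sum {α ι E : Type*} [MeasurableSpace α]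
    [NormedAddCommGroup E] {μ : Measure α} {l : Filter α} {f : ι → α → E} {S : Finset ι} {k : ι}
    (hk : k ∈ S) (hsum : IntegrableAtFilter (fun x => ∑ i ∈ S, f i x) l μ)
    (hf : ∀ i ∈ S, i ≠ k → IntegrableAtFilter (f i) l μ) :
    IntegrableAtFilter (f k) l μ := by
  classical
  have hrest : IntegrableAtFilter (fun x => ∑ i ∈ S.erase k, f i x) l μ :=
    .finset_sum fun i hi => hf i (Finset.mem_of_mem_erase hi) (Finset.ne_of_mem_erase hi)
  have heq : f k = (fun x => ∑ i ∈ S, f i x) - fun x => ∑ i ∈ S.erase k, f i x := by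
    ext x
    simp [← Finset.add_sum_erase S (fun i => f i x) hk]
  rw [heq]
  exact hsum.sub hrest

theorem MeasureTheory.integrableAtFilter_nhds_iff_exists_Ioo {E : Type*} [NormedAddCommGroup E]
    {f : ℝ → E} {a : ℝ} {μ : Measure ℝ} :
    IntegrableAtFilter f (nhds a) μ ↔
      ∃ δ > 0, IntegrableOn f (Set.Ioo (a - δ) (a + δ)) μ := by
  constructor
  · rintro ⟨u, hu, hfu⟩
    obtain ⟨δ, hδ, hsub⟩ := (nhds_basis_Ioo_pos a).mem_iff.1 hu
    exact ⟨δ, hδ, hfu.mono_set hsub⟩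
  · rintro ⟨δ, hδ, hf⟩
    exact ⟨_, (nhds_basis_Ioo_pos a).mem_of_mem hδ, hf⟩


open MeasureTheory

/-- The claim of Example 1 and Remark 2 for arbitrary `s`: with singular quasimomenta
`t₁ < ... < t_s` in `(−π,π)` and measurable functions `g₁,...,g_{s+1}` such that (i) each `g_i`
is integrable on `(−π,π]` away from arbitrarily small neighborhoods of the `t_j`, and (ii) near
each `t_j` exactly the two functions `g_j, g_{j+1}` are nonintegrable while every other `g_i`
is integrable near `t_j`, no nonempty proper subset `S₁` of the indices gives an integrable sum
`∑_{i∈S₁} g_i` on `(−π,π]`; in particular the index set cannot be split into two disjoint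
nonempty subsets both of whose sums are integrable (the huddling over the whole set `𝕊` is
necessary). -/
theorem statement12 (s : ℕ) (hs : 1 ≤ s) (t : Fin s → ℝ)
    (ht : StrictMono t) (htmem : ∀ j, t j ∈ Set.Ioo (-Real.pi) Real.pi)
    (g : Fin (s + 1) → ℝ → ℂ) (hmeas : ∀ i, Measurable (g i))
    (hi : ∀ i, ∀ δ > 0, IntegrableOn (g i)
      (Set.Ioc (-Real.pi) Real.pi \ ⋃ j : Fin s, Set.Ioo (t j - δ) (t j + δ)) volume)
    (hii : ∀ j : Fin s,
      (∀ δ > 0, ¬ IntegrableOn (g j.castSucc) (Set.Ioo (t j - δ) (t j + δ)) volume ∧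
                ¬ IntegrableOn (g j.succ) (Set.Ioo (t j - δ) (t j + δ)) volume) ∧
      (∀ i : Fin (s + 1), i ≠ j.castSucc → i ≠ j.succ →
        ∃ δ > 0, IntegrableOn (g i) (Set.Ioo (t j - δ) (t j + δ)) volume)) :
    (∀ S₁ : Finset (Fin (s + 1)), S₁.Nonempty → S₁ ≠ Finset.univ →
      ¬ IntegrableOn (fun x => ∑ i ∈ S₁, g i x) (Set.Ioc (-Real.pi) Real.pi) volume) ∧
    ¬ ∃ S₁ : Finset (Fin (s + 1)), S₁.Nonempty ∧ S₁ᶜ.Nonempty ∧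
        IntegrableOn (fun x => ∑ i ∈ S₁, g i x) (Set.Ioc (-Real.pi) Real.pi) volume ∧
        IntegrableOn (fun x => ∑ i ∈ S₁ᶜ, g i x) (Set.Ioc (-Real.pi) Real.pi) volume := by
  have main : ∀ S₁ : Finset (Fin (s + 1)), S₁.Nonempty → S₁ ≠ Finset.univ →
      ¬ IntegrableOn (fun x => ∑ i ∈ S₁, g i x) (Set.Ioc (-Real.pi) Real.pi) volume := by
    intro S hne huniv hint
    obtain ⟨j, hj⟩ := Finset.exists_not_castSucc_mem_iff_succ_mem hne huniv
    have hsum : IntegrableAtFilter (fun x => ∑ i ∈ S, g i x) (nhds (t j)) volume :=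
      ⟨_, Ioc_mem_nhds (htmem j).1 (htmem j).2, hint⟩
    have hother : ∀ i, i ≠ j.castSucc → i ≠ j.succ →
        IntegrableAtFilter (g i) (nhds (t j)) volume := fun i h₁ h₂ =>
      integrableAtFilter_nhds_iff_exists_Ioo.2 ((hii j).2 i h₁ h₂)
    by_cases hc : j.castSucc ∈ S
    · have hs' : j.succ ∉ S := fun h => hj (iff_of_true hc h)
      obtain ⟨δ, hδ, h⟩ := integrableAtFilter_nhds_iff_exists_Ioo.1 <|
        hsum.of_finset_sum hc fun i hi hik => hother i hik (ne_of_mem_of_not_mem hi hs')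
      exact ((hii j).1 δ hδ).1 h
    · have hs' : j.succ ∈ S := by_contra fun h => hj (iff_of_false hc h)
      obtain ⟨δ, hδ, h⟩ := integrableAtFilter_nhds_iff_exists_Ioo.1 <|
        hsum.of_finset_sum hs' fun i hi hik => hother i (ne_of_mem_of_not_mem hi hc) hik
      exact ((hii j).1 δ hδ).2 h
  refine ⟨main, ?_⟩
  rintro ⟨S, hne, hcompl, hint, -⟩
  exact main S hne (fun h => by simp [h] at hcompl) hint
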